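/- Under the same setup with α = 3/2, the unfolded third derivatives satisfy ε^{3/2} ∂³h_ε/∂x_i∂x_j∂x_k (ε[x̄/ε]+εȳ, ε y_N) → ∂³(b(ȳ)(y_N+1)⁴)/∂y_i∂y_j∂y_k as ε → 0, uniformly for (ȳ,y_N) ∈ Y × (−1,0) and uniformly in x̄, for all i,j,k = 1,…,N; moreover the unfolded functions are independent of x̄. -/

import Mathlib

open MeasureTheory Set Topology Filter

theorem iteratedFDeriv_comp_const_add_clm_apply {E F G : Type*}
    [NormedAddCommGroup E] [NormedSpace ℝ E] [NormedAddCommGroup F] [NormedSpace ℝ F]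
    [NormedAddCommGroup G] [NormedSpace ℝ G] {f : F → G} (hf : ContDiff ℝ (⊤ : ℕ∞) f)
    (a : F) (L : E →L[ℝ] F) (i : ℕ) (x : E) (m : Fin i → E) :
    iteratedFDeriv ℝ i (fun y => f (a + L y)) x m
      = iteratedFDeriv ℝ i f (a + L x) (fun j => L (m j)) := by
  have hf' : ContDiff ℝ (⊤ : ℕ∞) (fun z => f (a + z)) := by fun_prop
  have h := L.iteratedFDeriv_comp_right hf' x (i := i) (by exact_mod_cast le_top)
  have h2 := iteratedFDeriv_comp_add_left (𝕜 := ℝ) (f := f) i a (L x)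
  change iteratedFDeriv ℝ i ((fun z => f (a + z)) ∘ L) x m = _
  rw [h, h2]
  rfl

theorem apply_add_intCast_of_periodic_single {n : ℕ} {b : (Fin n → ℝ) → ℝ}
    (hb : ∀ (x : Fin n → ℝ) (i : Fin n), b (x + Pi.single i 1) = b x)
    (k : Fin n → ℤ) (x : Fin n → ℝ) : b (x + fun i => (k i : ℝ)) = b x := by
  have hp : ∀ i, Function.Periodic b (Pi.single i (1 : ℝ)) := fun i x => hb x i
  have hs : ∀ s : Finset (Fin n), ∀ x,
      b (x + ∑ i ∈ s, k i • Pi.single i (1 : ℝ)) = b x := by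
    intro s
    induction s using Finset.induction_on with
    | empty => simp
    | insert i s hi ih =>
      intro x
      rw [Finset.sum_insert hi, ← add_assoc, ih, (hp i).zsmul (k i) x]
  rw [← hs Finset.univ x]
  congr 2
  ext j
  simp [Finset.sum_apply, Pi.single_apply]

/-- The rescaled profile, in the parameter `s` with `ε = s ^ 4`. -/
noncomputable def rescaledProfile {n : ℕ} (b : (Fin n → ℝ) → ℝ)
    (z : ℝ × ((Fin n → ℝ) × ℝ)) : ℝ :=
  b z.2.1 * (z.2.2 + 1) ^ 4 * ((1 + z.1 ^ 2 * b z.2.1) ^ 4)⁻¹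

theorem contDiff_rescaledProfile {n : ℕ} {b : (Fin n → ℝ) → ℝ}
    (hb : ContDiff ℝ (⊤ : ℕ∞) b) (hb0 : ∀ x, 0 ≤ b x) :
    ContDiff ℝ (⊤ : ℕ∞) (rescaledProfile b) := by
  unfold rescaledProfile
  refine ContDiff.mul (by fun_prop) (ContDiff.inv (by fun_prop) fun z => ?_)
  have := hb0 z.2.1
  positivity

theorem continuous_iteratedFDeriv_rescaledProfile {n : ℕ} {b : (Fin n → ℝ) → ℝ}
    (hb : ContDiff ℝ (⊤ : ℕ∞) b) (hb0 : ∀ x, 0 ≤ b x) {i : ℕ}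
    (m : Fin i → ℝ × ((Fin n → ℝ) × ℝ)) :
    Continuous fun z => iteratedFDeriv ℝ i (rescaledProfile b) z m := by
  have := (contDiff_rescaledProfile hb hb0).continuous_iteratedFDeriv (m := i)
    (by exact_mod_cast le_top)
  fun_prop

theorem iteratedFDeriv_mul_pow_eq_rescaledProfile {n : ℕ} {b : (Fin n → ℝ) → ℝ}
    (hb : ContDiff ℝ (⊤ : ℕ∞) b) (hb0 : ∀ x, 0 ≤ b x) {i : ℕ}
    (q : (Fin n → ℝ) × ℝ) (m : Fin i → (Fin n → ℝ) × ℝ) :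
    iteratedFDeriv ℝ i (fun q : (Fin n → ℝ) × ℝ => b q.1 * (q.2 + 1) ^ 4) q m
      = iteratedFDeriv ℝ i (rescaledProfile b) (0, q) (fun r => (0, m r)) := by
  have h := iteratedFDeriv_comp_const_add_clm_apply (contDiff_rescaledProfile hb hb0) 0
    (ContinuousLinearMap.inr ℝ ℝ ((Fin n → ℝ) × ℝ)) i q m
  simpa [rescaledProfile] using h

/-- The chain rule for `h = s ^ 6 • rescaledProfile (s, · / s ^ 4 - (k, 0))` near the unfolding
point. -/
theorem iteratedFDeriv_three_unfolded {n : ℕ} {b : (Fin n → ℝ) → ℝ}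
    (hb : ContDiff ℝ (⊤ : ℕ∞) b) (hb0 : ∀ x, 0 ≤ b x)
    (hb_per : ∀ (x : Fin n → ℝ) (i : Fin n), b (x + Pi.single i 1) = b x)
    {s : ℝ} (hs : 0 < s) {h : (Fin n → ℝ) × ℝ → ℝ}
    (hh : ∀ p, h p = if p.2 ≤ -s ^ 4 then 0 else
      s ^ 6 * b ((s ^ 4)⁻¹ • p.1) * ((p.2 + s ^ 4) / (s ^ 6 * b ((s ^ 4)⁻¹ • p.1) + s ^ 4)) ^ 4)
    (k : Fin n → ℤ) {q : (Fin n → ℝ) × ℝ} (hq : -1 < q.2) (m : Fin 3 → (Fin n → ℝ) × ℝ) :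
    s ^ 6 * iteratedFDeriv ℝ 3 h (s ^ 4 • ((fun i => (k i : ℝ)) + q.1), s ^ 4 * q.2) m
      = iteratedFDeriv ℝ 3 (rescaledProfile b) (s, q) (fun r => (0, m r)) := by
  set p₀ : (Fin n → ℝ) × ℝ := (s ^ 4 • ((fun i => (k i : ℝ)) + q.1), s ^ 4 * q.2) with hp₀
  set a : ℝ × ((Fin n → ℝ) × ℝ) := (s, (-(fun i => (k i : ℝ)), 0)) with ha
  set L : ((Fin n → ℝ) × ℝ) →L[ℝ] ℝ × ((Fin n → ℝ) × ℝ) :=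
    (s ^ 4)⁻¹ • ContinuousLinearMap.inr ℝ ℝ ((Fin n → ℝ) × ℝ) with hL
  have hF := contDiff_rescaledProfile hb hb0
  have hev : h =ᶠ[𝓝 p₀] s ^ 6 • fun p => rescaledProfile b (a + L p) := by
    have hp : -s ^ 4 < p₀.2 := by
      have := mul_lt_mul_of_pos_left hq (pow_pos hs 4)
      simpa [hp₀] using this
    filter_upwards [continuous_snd.continuousAt.eventually (lt_mem_nhds hp)] with p hp
    have hbk : b (-(fun i => (k i : ℝ)) + (s ^ 4)⁻¹ • p.1) = b ((s ^ 4)⁻¹ • p.1) := by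
      rw [← apply_add_intCast_of_periodic_single hb_per k]
      congr 1
      abel
    rw [hh, if_neg (not_le.2 hp)]
    simp only [Pi.smul_apply, smul_eq_mul, rescaledProfile, ha, hL, Prod.fst_add, Prod.snd_add,
      smul_apply, ContinuousLinearMap.inr_apply, Prod.smul_fst, Prod.smul_snd,
      mul_zero, add_zero, zero_add, hbk]
    have h0 := hb0 ((s ^ 4)⁻¹ • p.1)
    generalize b ((s ^ 4)⁻¹ • p.1) = t at h0
    have h1 : 1 + s ^ 2 * t ≠ 0 := by positivity
    have h2 : s ^ 6 * t + s ^ 4 = s ^ 4 * (1 + s ^ 2 * t) := by ring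
    rw [h2]
    field_simp
  have hpt : a + L p₀ = (s, q) := by
    have h4 : s ^ 4 ≠ 0 := by positivity
    ext
    · simp [ha, hL]
    · simp [ha, hL, hp₀, h4]
    · simp [ha, hL, hp₀, h4]
  have hcomp : ContDiff ℝ (⊤ : ℕ∞) fun p => rescaledProfile b (a + L p) := by fun_prop
  rw [(hev.iteratedFDeriv ℝ 3).eq_of_nhds, iteratedFDeriv_const_smul_apply
    (contDiff_infty.1 hcomp 3).contDiffAt, smul_apply,
    iteratedFDeriv_comp_const_add_clm_apply hF, hpt]
  have hLm : (fun r => L (m r)) = fun r => (s ^ 4)⁻¹ • ((0, m r) : ℝ × ((Fin n → ℝ) × ℝ)) := by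
    ext r <;> simp [hL]
  rw [hLm, ContinuousMultilinearMap.map_smul_univ]
  simp only [Finset.prod_const, Finset.card_univ, Fintype.card_fin, smul_eq_mul]
  field_simp

/-- with `α = 3/2`, the unfolded third derivatives of `h_ε`
satisfy `ε^{3/2} ∂³h_ε/∂x_i∂x_j∂x_k (ε[x̄/ε]+εȳ, εy_N)
→ ∂³(b(ȳ)(y_N+1)⁴)/∂y_i∂y_j∂y_k` as `ε → 0⁺`, uniformly on `Y × (-1,0)` and
uniformly in `x̄` (the unfolded functions are independent of `x̄`, i.e. of the
cell index `k`). -/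
theorem stmt14 (n : ℕ) (hn : 1 ≤ n)
    (b : (Fin n → ℝ) → ℝ) (hb : ContDiff ℝ (⊤ : ℕ∞) b)
    (hb_bdd : ∀ m : ℕ, ∃ M : ℝ, ∀ x, ‖iteratedFDeriv ℝ m b x‖ ≤ M)
    (hb_per : ∀ (x : Fin n → ℝ) (i : Fin n), b (x + Pi.single i 1) = b x)
    (hb_nonneg : ∀ x, 0 ≤ b x)
    (g : ℝ → (Fin n → ℝ) → ℝ)
    (hg : ∀ ε x, g ε x = ε ^ ((3:ℝ)/2) * b (ε⁻¹ • x))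
    (h : ℝ → (Fin n → ℝ) × ℝ → ℝ)
    (hh : ∀ (ε : ℝ) (p : (Fin n → ℝ) × ℝ),
      h ε p = if p.2 ≤ -ε then 0 else g ε p.1 * ((p.2 + ε) / (g ε p.1 + ε)) ^ 4)
    (e : Fin (n + 1) → (Fin n → ℝ) × ℝ)
    (he : ∀ i : Fin (n + 1), e i = if hi : (i : ℕ) < n
      then (Pi.single (⟨i, hi⟩ : Fin n) 1, 0) else (0, 1))
    -- the unfolding evaluation point `(ε k + ε ȳ, ε y_N)`, `k = [x̄/ε]`
    (pt : ℝ → (Fin n → ℤ) → (Fin n → ℝ) × ℝ → (Fin n → ℝ) × ℝ)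
    (hpt : ∀ ε k q, pt ε k q = (ε • ((fun i => ((k i : ℤ) : ℝ)) + q.1), ε * q.2))
    (B : (Fin n → ℝ) × ℝ → ℝ) (hB : ∀ q, B q = b q.1 * (q.2 + 1) ^ 4)
    (Y : Set (Fin n → ℝ))
    (hY : Y = Set.univ.pi fun _ => Set.Ioo (-(1:ℝ)/2) (1/2)) :
    (∀ (i j l : Fin (n + 1)) (k : Fin n → ℤ),
      TendstoUniformlyOn
        (fun (ε : ℝ) (q : (Fin n → ℝ) × ℝ) =>
          ε ^ ((3:ℝ)/2) * iteratedFDeriv ℝ 3 (h ε) (pt ε k q) ![e i, e j, e l])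
        (fun q => iteratedFDeriv ℝ 3 B q ![e i, e j, e l])
        (𝓝[>] (0:ℝ)) (Y ×ˢ Set.Ioo (-1 : ℝ) 0)) ∧
    (∃ ε₀ : ℝ, 0 < ε₀ ∧ ∀ ε : ℝ, 0 < ε → ε < ε₀ →
      ∀ (i j l : Fin (n + 1)) (k k' : Fin n → ℤ),
        ∀ q ∈ Y ×ˢ Set.Ioo (-1 : ℝ) 0,
          iteratedFDeriv ℝ 3 (h ε) (pt ε k q) ![e i, e j, e l] =
            iteratedFDeriv ℝ 3 (h ε) (pt ε k' q) ![e i, e j, e l]) := by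
  obtain rfl : Y = _ := hY
  obtain rfl : B = fun q => b q.1 * (q.2 + 1) ^ 4 := funext hB
  set S : ℝ → ℝ := fun ε => √(√ε) with hS
  have hS_pos : ∀ ε : ℝ, 0 < ε → 0 < S ε := fun ε hε => by positivity
  have hS4 : ∀ ε : ℝ, 0 < ε → S ε ^ 4 = ε := fun ε hε => by
    rw [show S ε ^ 4 = (S ε ^ 2) ^ 2 by ring, Real.sq_sqrt (by positivity), Real.sq_sqrt hε.le]
  have hS6 : ∀ ε : ℝ, 0 < ε → ε ^ ((3 : ℝ) / 2) = S ε ^ 6 := fun ε hε => by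
    rw [show S ε ^ 6 = (S ε ^ 2) ^ 3 by ring, Real.sq_sqrt (by positivity), Real.sqrt_eq_rpow,
      ← Real.rpow_natCast, ← Real.rpow_mul hε.le]
    norm_num
  have key : ∀ ε : ℝ, 0 < ε → ∀ (m : Fin 3 → (Fin n → ℝ) × ℝ) (k : Fin n → ℤ),
      ∀ q : (Fin n → ℝ) × ℝ, -1 < q.2 →
        ε ^ ((3 : ℝ) / 2) * iteratedFDeriv ℝ 3 (h ε) (pt ε k q) m
          = iteratedFDeriv ℝ 3 (rescaledProfile b) (S ε, q) (fun r => (0, m r)) := by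
    intro ε hε m k q hq
    have := iteratedFDeriv_three_unfolded hb hb_nonneg hb_per (hS_pos ε hε) (h := h ε)
      (fun p => by rw [hh, hg, hS6 ε hε, hS4 ε hε]) k hq m
    rwa [hS4 ε hε, ← hS6 ε hε, ← hpt] at this
  refine ⟨fun i j l k => ?_, 1, one_pos, fun ε hε _ i j l k k' q hq => ?_⟩
  · set m := ![e i, e j, e l]
    have hcont := continuous_iteratedFDeriv_rescaledProfile hb hb_nonneg
      (fun r => ((0, m r) : ℝ × ((Fin n → ℝ) × ℝ)))
    have hK : IsCompact ((univ.pi fun _ : Fin n => Icc (-(1 : ℝ) / 2) (1 / 2)) ×ˢ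
        Icc (-1 : ℝ) 0) := (isCompact_univ_pi fun _ => isCompact_Icc).prod isCompact_Icc
    intro u hu
    obtain ⟨v, hv, hvu⟩ := hK.mem_uniformity_of_prod (s := univ) (q := (0 : ℝ))
      (f := fun s q => iteratedFDeriv ℝ 3 (rescaledProfile b) (s, q) (fun r => (0, m r)))
      hcont.continuousOn (mem_univ _) (symm_le_uniformity hu)
    rw [nhdsWithin_univ] at hv
    have hS0 : Tendsto S (𝓝[>] 0) (𝓝 0) := by
      have hc : Continuous S := by fun_prop
      have := hc.tendsto 0
      simp only [hS, Real.sqrt_zero] at this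
      exact this.mono_left nhdsWithin_le_nhds
    filter_upwards [hS0 hv, self_mem_nhdsWithin] with ε hεv hε q hq
    have hqK := prod_mono (pi_mono fun _ _ => Ioo_subset_Icc_self) Ioo_subset_Icc_self hq
    simp only [key ε hε m k q hq.2.1, iteratedFDeriv_mul_pow_eq_rescaledProfile hb hb_nonneg]
    exact hvu _ hεv q hqK
  · have hε' : ε ^ ((3 : ℝ) / 2) ≠ 0 := (Real.rpow_pos_of_pos hε _).ne'
    exact mul_left_cancel₀ hε'
      ((key ε hε _ k q hq.2.1).trans (key ε hε _ k' q hq.2.1).symm)
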